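/- arXiv:1904.11069 — 2 statements merged into one kernel-verified Lean document; each statement's English description precedes it below -/
import Mathlib

section
/- Let R=(R_1,…,R_m) and S=(S_1,…,S_n) be partitions of the same weight such that A(R,S) is nonempty, and let t be a positive integer. Then the minimum t-term rank over the class satisfies ρ̃_t(R,S) = min{ t·e + f : 0 ≤ e ≤ m, 0 ≤ f ≤ n, and φ_{e,f} = t_{e,f} }. -/
open Finset

/-- `A` is a `(0,1)`-matrix: every entry is `0` or `1`. -/
def IsZeroOne {m n : ℕ} (A : Matrix (Fin m) (Fin n) ℕ) : Prop :=
  ∀ i j, A i j = 0 ∨ A i j = 1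

/-- The class `𝒜(R,S)` of `(0,1)`-matrices with row sum vector `R` and
column sum vector `S`. -/
def ARS {m n : ℕ} (R : Fin m → ℕ) (S : Fin n → ℕ) :
    Set (Matrix (Fin m) (Fin n) ℕ) :=
  {A | IsZeroOne A ∧ (∀ i, ∑ j, A i j = R i) ∧ (∀ j, ∑ i, A i j = S j)}

/-- `R` and `S` are partitions of the same weight. -/
def IsPartitionPair {m n : ℕ} (R : Fin m → ℕ) (S : Fin n → ℕ) : Prop :=
  Antitone R ∧ (∀ i, 0 < R i) ∧ Antitone S ∧ (∀ j, 0 < S j) ∧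
    ∑ i, R i = ∑ j, S j

/-- The rows `E` and the columns `F` cover all the `1`'s of `A`. -/
def Covers {m n : ℕ} (A : Matrix (Fin m) (Fin n) ℕ)
    (E : Finset (Fin m)) (F : Finset (Fin n)) : Prop :=
  ∀ i j, A i j = 1 → i ∈ E ∨ j ∈ F

/-- The `t`-term rank of `A`: the maximum number of `1`'s of `A` with at most
one `1` in each column and at most `t` `1`'s in each row. -/
def tTermRank {m n : ℕ} (t : ℕ) (A : Matrix (Fin m) (Fin n) ℕ) : ℕ :=
  Finset.sup ((Finset.univ : Finset (Fin m × Fin n)).powerset.filter fun P =>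
      (∀ p ∈ P, A p.1 p.2 = 1) ∧
      (∀ j : Fin n, (P.filter fun p => p.2 = j).card ≤ 1) ∧
      (∀ i : Fin m, (P.filter fun p => p.1 = i).card ≤ t))
    Finset.card

/-- The minimum `t`-term rank over the class `𝒜(R,S)`. -/
noncomputable def minTermRank {m n : ℕ} (t : ℕ) (R : Fin m → ℕ)
    (S : Fin n → ℕ) : ℕ :=
  sInf {r : ℕ | ∃ A ∈ ARS R S, tTermRank t A = r}

/-- The structure matrix `t_{k,l}` associated with `R` and `S`
(`R`, `S` being 1-indexed in the paper, here 0-indexed):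
`t_{k,l} = k·l − ∑_{j=1}^{l} S_j + ∑_{i=k+1}^{m} R_i`. -/
def structMat {m n : ℕ} (R : Fin m → ℕ) (S : Fin n → ℕ) (k l : ℕ) : ℤ :=
  (k : ℤ) * l - ∑ j ∈ Finset.univ.filter (fun j : Fin n => (j : ℕ) < l), (S j : ℤ)
    + ∑ i ∈ Finset.univ.filter (fun i : Fin m => k ≤ (i : ℕ)), (R i : ℤ)

/-- `φ_{k,l} = min { t_{i1,l+j2} + t_{k+i2,j1} + (k−i1)(l−j1) }` over all
`0 ≤ i1 ≤ k ≤ k+i2 ≤ m` and `0 ≤ j1 ≤ l ≤ l+j2 ≤ n`. -/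
noncomputable def phi {m n : ℕ} (R : Fin m → ℕ) (S : Fin n → ℕ) (k l : ℕ) : ℤ :=
  sInf {v : ℤ | ∃ i1 i2 j1 j2 : ℕ,
    i1 ≤ k ∧ k + i2 ≤ m ∧ j1 ≤ l ∧ l + j2 ≤ n ∧
    v = structMat R S i1 (l + j2) + structMat R S (k + i2) j1
        + ((k : ℤ) - i1) * ((l : ℤ) - j1)}

/-- `ψ_{a,b;c,d}` as in the paper, the minimum being taken over all
`0 ≤ i1 ≤ a ≤ a+i2 ≤ b ≤ b+i3 ≤ m` and `0 ≤ j1 ≤ c ≤ c+j2 ≤ d ≤ d+j3 ≤ n`. -/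
noncomputable def psi {m n : ℕ} (R : Fin m → ℕ) (S : Fin n → ℕ)
    (a b c d : ℕ) : ℤ :=
  sInf {v : ℤ | ∃ i1 i2 i3 j1 j2 j3 : ℕ,
    i1 ≤ a ∧ a + i2 ≤ b ∧ b + i3 ≤ m ∧
    j1 ≤ c ∧ c + j2 ≤ d ∧ d + j3 ≤ n ∧
    v = structMat R S i1 (d + j3) + structMat R S (a + i2) (c + j2)
        + structMat R S (b + i3) j1
        + ((a : ℤ) - i1) * ((d : ℤ) - (c : ℤ) - j2)
        + ((b : ℤ) - (a : ℤ) - i2) * ((c : ℤ) - j1)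
        + ((a : ℤ) - i1) * ((c : ℤ) - j1)}


section TermRank

variable {m n : ℕ} {t : ℕ} {A : Matrix (Fin m) (Fin n) ℕ}

theorem tTermRank_le_of_covers {E : Finset (Fin m)} {F : Finset (Fin n)} (h : Covers A E F) :
    tTermRank t A ≤ t * #E + #F := by
  refine Finset.sup_le fun P hP => ?_
  obtain ⟨-, hA, hcol, hrow⟩ := Finset.mem_filter.1 hP
  have hsub : P ⊆ (E.biUnion fun i => P.filter fun p => p.1 = i) ∪
      (F.biUnion fun j => P.filter fun p => p.2 = j) := by
    intro p hp
    have := h p.1 p.2 (hA p hp)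
    simp only [mem_union, mem_biUnion, mem_filter]
    grind
  calc #P ≤ _ := card_le_card hsub
    _ ≤ _ := card_union_le _ _
    _ ≤ #E * t + #F * 1 := add_le_add (card_biUnion_le_card_mul _ _ _ fun i _ => hrow i)
        (card_biUnion_le_card_mul _ _ _ fun j _ => hcol j)
    _ = t * #E + #F := by ring

theorem le_tTermRank {d : ℕ} (hd : d ≤ n) (h : ∀ E F, Covers A E F → d ≤ t * #E + #F) :
    d ≤ tTermRank t A := by
  let N : Fin n → Finset (Fin m) := fun j => univ.filter fun i => A i j = 1
  let T : Fin n → Finset ((Fin m × Fin t) ⊕ Fin (n - d)) := fun j =>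
    (N j ×ˢ univ).disjSum univ
  obtain ⟨g, hg, hgT⟩ := (all_card_le_biUnion_card_iff_exists_injective T).1 <| by
    intro J
    rcases J.eq_empty_or_nonempty with rfl | ⟨j₀, hj₀⟩
    · simp
    have hsub : ((J.biUnion N) ×ˢ univ).disjSum univ ⊆ J.biUnion T := by
      rintro (⟨i, x⟩ | y) hx
      · simpa [T] using hx
      · simpa [T] using ⟨j₀, hj₀⟩
    have hc := h (J.biUnion N) Jᶜ (by
      intro i j hij
      by_cases hj : j ∈ J
      · exact Or.inl (mem_biUnion.2 ⟨j, hj, by simpa [N] using hij⟩)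
      · exact Or.inr (by simpa using hj))
    have hle := card_le_card hsub
    have hJ := card_le_univ J
    rw [card_compl] at hc
    simp only [card_disjSum, card_product, card_univ, Fintype.card_fin] at hle hc hJ
    rw [mul_comm] at hle
    omega
  let P : Finset (Fin m × Fin n) := univ.filter fun p => ∃ x, g p.2 = Sum.inl (p.1, x)
  have hP : P ∈ (Finset.univ : Finset (Fin m × Fin n)).powerset.filter fun P =>
      (∀ p ∈ P, A p.1 p.2 = 1) ∧
      (∀ j : Fin n, (P.filter fun p => p.2 = j).card ≤ 1) ∧
      (∀ i : Fin m, (P.filter fun p => p.1 = i).card ≤ t) := by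
    refine mem_filter.2 ⟨by simp, ?_, ?_, ?_⟩
    · intro p hp
      obtain ⟨x, hx⟩ := (mem_filter.1 hp).2
      have := hgT p.2
      rw [hx] at this
      simpa [T, N] using this
    · intro j
      refine card_le_one.2 ?_
      rintro ⟨i, j'⟩ hp ⟨i', j''⟩ hq
      simp only [P, mem_filter, mem_univ, true_and] at hp hq
      obtain ⟨⟨x, hx⟩, rfl⟩ := hp
      obtain ⟨⟨y, hy⟩, rfl⟩ := hq
      rw [hx] at hy
      simp only [Sum.inl.injEq, Prod.mk.injEq] at hy
      rw [hy.1]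
    · intro i
      calc _ ≤ #((univ : Finset (Fin t)).image fun x =>
              (Sum.inl (i, x) : (Fin m × Fin t) ⊕ Fin (n - d))) := by
            refine card_le_card_of_injOn (fun p => g p.2) ?_ ?_
            · intro p hp
              simp only [P, coe_filter, mem_filter, mem_univ, true_and, Set.mem_ofPred_eq] at hp
              obtain ⟨⟨x, hx⟩, rfl⟩ := hp
              simp [hx]
            · intro p hp q hq hpq
              simp only [P, coe_filter, mem_filter, mem_univ, true_and, Set.mem_ofPred_eq] at hp hq
              exact Prod.ext (hp.2.trans hq.2.symm) (hg hpq)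
        _ ≤ t := card_image_le.trans (by simp)
  refine le_trans ?_ (Finset.le_sup (f := Finset.card) hP)
  have hcover : (univ : Finset (Fin n)).image g ⊆
      (P.image fun p => g p.2) ∪ univ.image Sum.inr := by
    intro y hy
    obtain ⟨j, -, rfl⟩ := mem_image.1 hy
    rcases hj : g j with ⟨i, x⟩ | y
    · refine mem_union_left _ (mem_image.2 ⟨(i, j), ?_, hj⟩)
      simp [P, hj]
    · simp
  have h₁ := (card_le_card hcover).trans (card_union_le _ _)
  have h₂ := (card_image_le : #(P.image fun p => g p.2) ≤ #P)
  have h₃ := (card_image_le : #((univ : Finset (Fin (n - d))).image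
    (Sum.inr : _ → (Fin m × Fin t) ⊕ Fin (n - d))) ≤ _)
  rw [card_image_of_injective _ hg] at h₁
  simp only [card_univ, Fintype.card_fin] at h₁ h₃
  omega

/-- König duality for the `t`-term rank. -/
theorem exists_covers_eq_tTermRank (t : ℕ) (A : Matrix (Fin m) (Fin n) ℕ) :
    ∃ E F, Covers A E F ∧ t * #E + #F = tTermRank t A := by
  let 𝒞 : Set (Finset (Fin m) × Finset (Fin n)) := {p | Covers A p.1 p.2}
  have hne : ((∅ : Finset (Fin m)), (univ : Finset (Fin n))) ∈ 𝒞 := by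
    intro i j _
    simp
  obtain ⟨p, hp, hmin⟩ := Set.exists_min_image 𝒞 (fun p => t * #p.1 + #p.2)
    (Set.toFinite _) ⟨_, hne⟩
  refine ⟨p.1, p.2, hp, le_antisymm (le_tTermRank ?_ fun E F h => hmin (E, F) h)
    (tTermRank_le_of_covers hp)⟩
  simpa using hmin _ hne

end TermRank

section Feasibility

variable {α β : Type*} [DecidableEq α] [DecidableEq β]

theorem card_filter_cut_submodular (G : Finset (α × β)) (X X' : Finset α) (Y Y' : Finset β) :
    #(G.filter fun p => p.1 ∈ X ∪ X' ∧ p.2 ∉ Y ∪ Y') +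
        #(G.filter fun p => p.1 ∈ X ∩ X' ∧ p.2 ∉ Y ∩ Y') ≤
      #(G.filter fun p => p.1 ∈ X ∧ p.2 ∉ Y) + #(G.filter fun p => p.1 ∈ X' ∧ p.2 ∉ Y') := by
  simp only [card_filter, ← sum_add_distrib]
  refine sum_le_sum fun p _ => ?_
  simp only [mem_union, mem_inter]
  by_cases p.1 ∈ X <;> by_cases p.1 ∈ X' <;> by_cases p.2 ∈ Y <;> by_cases p.2 ∈ Y' <;> simp [*]

/-- A bipartite graph `G` has a subgraph with prescribed degrees `r` and `s` as soon as no cut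
obstructs it. -/
theorem exists_subgraph_of_cut_condition [Fintype α] [Fintype β] (G : Finset (α × β)) :
    ∀ (r : α → ℤ) (s : β → ℤ), ∑ i, r i = ∑ j, s j →
      (∀ X Y, ∑ i ∈ X, r i ≤ ∑ j ∈ Y, s j + #(G.filter fun p => p.1 ∈ X ∧ p.2 ∉ Y)) →
      ∃ P ⊆ G, (∀ i, (#(P.filter fun p => p.1 = i) : ℤ) = r i) ∧
        ∀ j, (#(P.filter fun p => p.2 = j) : ℤ) = s j := by
  induction G using Finset.induction_on with
  | empty =>
    intro r s hrs h
    refine ⟨∅, subset_rfl, fun i => ?_, fun j => ?_⟩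
    · have h₁ := h {i} ∅
      have h₂ := h {i}ᶜ univ
      have h₃ := sum_compl_add_sum {i} r
      simp only [filter_empty, sum_singleton, sum_empty, card_empty] at *
      push_cast at *
      linarith
    · have h₁ := h ∅ {j}
      have h₂ := h univ {j}ᶜ
      have h₃ := sum_compl_add_sum {j} s
      simp only [filter_empty, sum_singleton, sum_empty, card_empty] at *
      push_cast at *
      linarith
  | insert e G he ih =>
    intro r s hrs h
    by_cases h₁ : ∀ X Y, ∑ i ∈ X, r i ≤ ∑ j ∈ Y, s j + #(G.filter fun p => p.1 ∈ X ∧ p.2 ∉ Y)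
    · obtain ⟨P, hP, hr, hs⟩ := ih r s hrs h₁
      exact ⟨P, hP.trans (subset_insert _ _), hr, hs⟩
    by_cases h₂ : ∀ X Y, ∑ i ∈ X, (r i - if e.1 = i then 1 else 0) ≤
        ∑ j ∈ Y, (s j - if e.2 = j then 1 else 0) + #(G.filter fun p => p.1 ∈ X ∧ p.2 ∉ Y)
    · obtain ⟨P, hP, hr, hs⟩ := ih _ _ (by simp [hrs]) h₂
      have heP : e ∉ P := fun h => he (hP h)
      refine ⟨insert e P, insert_subset_insert _ hP, fun i => ?_, fun j => ?_⟩
      · have := hr i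
        rw [filter_insert]
        split_ifs at this ⊢
        · rw [card_insert_of_notMem (by simp [heP])]
          push_cast
          linarith
        · linarith
      · have := hs j
        rw [filter_insert]
        split_ifs at this ⊢
        · rw [card_insert_of_notMem (by simp [heP])]
          push_cast
          linarith
        · linarith
    push Not at h₁ h₂
    obtain ⟨X, Y, h₁⟩ := h₁
    obtain ⟨X', Y', h₂⟩ := h₂
    exfalso
    have hsub := card_filter_cut_submodular G X X' Y Y'
    have hu := h (X ∪ X') (Y ∪ Y')
    have hi := h (X ∩ X') (Y ∩ Y')
    have hr := sum_union_inter (s₁ := X) (s₂ := X') (f := r)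
    have hs := sum_union_inter (s₁ := Y) (s₂ := Y') (f := s)
    have hcard : ∀ (X : Finset α) (Y : Finset β), #((insert e G).filter fun p => p.1 ∈ X ∧ p.2 ∉ Y) =
        #(G.filter fun p => p.1 ∈ X ∧ p.2 ∉ Y) + if e.1 ∈ X ∧ e.2 ∉ Y then 1 else 0 := by
      intro X Y
      rw [filter_insert]
      split_ifs
      · rw [card_insert_of_notMem (by simp [he])]
      · simp
    rw [hcard] at hu hi
    simp only [sum_sub_distrib, sum_ite_eq] at h₂
    simp only [mem_union, mem_inter] at hu hi hsub
    by_cases e.1 ∈ X' <;> by_cases e.2 ∈ Y' <;> simp only [*] at hu hi h₂ <;>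
      split_ifs at hu hi <;> simp at * <;> omega

end Feasibility

section Normalization

variable {m n : ℕ}

theorem transpose_mem_ARS {R : Fin m → ℕ} {S : Fin n → ℕ} {A : Matrix (Fin m) (Fin n) ℕ}
    (hA : A ∈ ARS R S) : A.transpose ∈ ARS S R :=
  ⟨fun i j => hA.1 j i, hA.2.2, hA.2.1⟩

theorem Covers.transpose {A : Matrix (Fin m) (Fin n) ℕ} {E : Finset (Fin m)}
    {F : Finset (Fin n)} (h : Covers A E F) : Covers A.transpose F E :=
  fun i j hij => (h j i hij).symm

/-- A covering row may be replaced by a row with at least as large a sum. -/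
theorem exists_covers_exchange {R : Fin m → ℕ} {S : Fin n → ℕ} {A : Matrix (Fin m) (Fin n) ℕ}
    (hA : A ∈ ARS R S) {E : Finset (Fin m)} {F : Finset (Fin n)} (h : Covers A E F)
    {p q : Fin m} (hp : p ∉ E) (hq : q ∈ E) (hpq : R q ≤ R p) :
    ∃ B ∈ ARS R S, Covers B (insert p (E.erase q)) F := by
  obtain ⟨h01, hrow, hcol⟩ := hA
  have hne : p ≠ q := fun hpq => hp (hpq ▸ hq)
  have hp0 : ∀ j ∉ F, A p j = 0 := fun j hj =>
    (h01 p j).resolve_right fun h1 => (h p j h1).elim hp hj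
  have hval : ∀ i (U : Finset (Fin n)), ∑ j ∈ U, A i j = #(U.filter fun j => A i j = 1) := by
    intro i U
    rw [card_filter]
    refine sum_congr rfl fun j _ => ?_
    rcases h01 i j with h | h <;> simp [h]
  have hle : #(Fᶜ.filter fun j => A q j = 1) ≤ #(F.filter fun j => A p j = 1 ∧ A q j = 0) := by
    have h₁ : ∑ j ∈ F, A p j = R p := by
      rw [← hrow p, ← sum_compl_add_sum F, sum_eq_zero (s := Fᶜ), zero_add]
      exact fun j hj => hp0 j (by simpa using hj)
    have h₂ : ∑ j ∈ Fᶜ, A q j + ∑ j ∈ F, A q j = R q := by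
      rw [← hrow q, sum_compl_add_sum]
    have h₃ : ∑ j ∈ F, A p j ≤
        #(F.filter fun j => A p j = 1 ∧ A q j = 0) + ∑ j ∈ F, A q j := by
      rw [card_filter, ← sum_add_distrib]
      refine sum_le_sum fun j _ => ?_
      rcases h01 p j with h | h <;> rcases h01 q j with h' | h' <;> simp [h, h']
    rw [← hval]
    omega
  obtain ⟨T, hT, hTcard⟩ := exists_subset_card_eq hle
  have hTF : ∀ j ∈ T, j ∈ F ∧ A p j = 1 ∧ A q j = 0 := fun j hj => by
    simpa using hT hj
  have hdisj : Disjoint T Fᶜ := by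
    rw [Finset.disjoint_left]
    exact fun j hj => by simpa using (hTF j hj).1
  have hsum : ∑ j ∈ T ∪ Fᶜ, A p j = ∑ j ∈ T ∪ Fᶜ, A q j := by
    rw [sum_union hdisj, sum_union hdisj, sum_congr rfl fun j hj => (hTF j hj).2.1,
      sum_congr rfl fun j hj => (hTF j hj).2.2, sum_congr rfl fun j hj => hp0 j (by simpa using hj),
      hval q, ← hTcard]
    simp
  refine ⟨fun i j => if j ∈ T ∪ Fᶜ then A (Equiv.swap p q i) j else A i j, ⟨?_, ?_, ?_⟩, ?_⟩
  · intro i j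
    dsimp only
    split_ifs
    exacts [h01 _ _, h01 _ _]
  · intro i
    have key : ∑ j ∈ T ∪ Fᶜ, A (Equiv.swap p q i) j = ∑ j ∈ T ∪ Fᶜ, A i j := by
      rcases eq_or_ne i p with rfl | hip
      · rw [Equiv.swap_apply_left, hsum]
      rcases eq_or_ne i q with rfl | hiq
      · rw [Equiv.swap_apply_right, hsum]
      rw [Equiv.swap_apply_of_ne_of_ne hip hiq]
    rw [← hrow i, ← sum_add_sum_compl (T ∪ Fᶜ), ← sum_add_sum_compl (T ∪ Fᶜ) (A i), ← key]
    congr 1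
    · exact sum_congr rfl fun j hj => if_pos hj
    · exact sum_congr rfl fun j hj => if_neg (mem_compl.1 hj)
  · intro j
    dsimp only
    split_ifs
    · rw [Equiv.sum_comp (Equiv.swap p q) fun i => A i j, hcol]
    · exact hcol j
  · intro i j hij
    by_cases hj : j ∈ F
    · exact Or.inr hj
    left
    dsimp only at hij
    rw [if_pos (by simp [hj])] at hij
    have hE := (h _ _ hij).resolve_right hj
    rcases eq_or_ne i p with rfl | hip
    · simp
    rcases eq_or_ne i q with rfl | hiq
    · rw [Equiv.swap_apply_right] at hE
      exact absurd hE hp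
    rw [Equiv.swap_apply_of_ne_of_ne hip hiq] at hE
    simp [hip, hiq, hE]

theorem exists_covers_initial_rows {R : Fin m → ℕ} {S : Fin n → ℕ} (hR : Antitone R)
    {F : Finset (Fin n)} (E : Finset (Fin m)) (h : ∃ A ∈ ARS R S, Covers A E F) :
    ∃ A ∈ ARS R S, Covers A (univ.filter fun i : Fin m => (i : ℕ) < #E) F := by
  let 𝒞 : Set (Finset (Fin m)) := {E' | #E' = #E ∧ ∃ A ∈ ARS R S, Covers A E' F}
  obtain ⟨E', ⟨hcard, A, hA, hcov⟩, hmin⟩ := Set.exists_min_image 𝒞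
    (fun E' => ∑ i ∈ E', (i : ℕ)) (Set.toFinite _) ⟨E, rfl, h⟩
  have hlower : ∀ p q, p < q → q ∈ E' → p ∈ E' := by
    intro p q hpq hq
    by_contra hp
    have hpe : p ∉ E'.erase q := fun h => hp (mem_of_mem_erase h)
    have := hmin (insert p (E'.erase q))
      ⟨by rw [card_insert_of_notMem hpe, card_erase_add_one hq, hcard],
        exists_covers_exchange hA hcov hp hq (hR hpq.le)⟩
    rw [sum_insert hpe, ← add_sum_erase _ _ hq] at this
    have : (p : ℕ) < q := hpq
    omega
  have hsub : E' ⊆ univ.filter fun i : Fin m => (i : ℕ) < #E := by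
    intro q hq
    have : Finset.Iic q ⊆ E' := fun p hp => by
      rcases (Finset.mem_Iic.1 hp).lt_or_eq with h | rfl
      exacts [hlower p q h hq, hq]
    have := card_le_card this
    rw [Fin.card_Iic, hcard] at this
    simp only [mem_filter, mem_univ, true_and]
    omega
  refine ⟨A, hA, fun i j hij => (hcov i j hij).imp_left fun h => hsub h⟩

theorem exists_covers_initial {R : Fin m → ℕ} {S : Fin n → ℕ} (hR : Antitone R)
    (hS : Antitone S) {A : Matrix (Fin m) (Fin n) ℕ} (hA : A ∈ ARS R S)
    {E : Finset (Fin m)} {F : Finset (Fin n)} (h : Covers A E F) :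
    ∃ B ∈ ARS R S, Covers B (univ.filter fun i : Fin m => (i : ℕ) < #E)
      (univ.filter fun j : Fin n => (j : ℕ) < #F) := by
  obtain ⟨B, hB, hBc⟩ := exists_covers_initial_rows hR E ⟨A, hA, h⟩
  obtain ⟨C, hC, hCc⟩ := exists_covers_initial_rows hS F
    ⟨B.transpose, transpose_mem_ARS hB, hBc.transpose⟩
  exact ⟨C.transpose, transpose_mem_ARS hC, hCc.transpose⟩

end Normalization

section StructureMatrix

variable {m n : ℕ} {R : Fin m → ℕ} {S : Fin n → ℕ}

theorem card_filter_Fin_Ico {a b : ℕ} (hb : b ≤ m) :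
    #(univ.filter fun i : Fin m => a ≤ (i : ℕ) ∧ (i : ℕ) < b) = b - a := by
  rw [← Nat.card_Ico, ← card_map Fin.valEmbedding]
  congr 1
  ext x
  simp only [mem_map, mem_filter, mem_univ, true_and, Fin.valEmbedding_apply, mem_Ico]
  exact ⟨fun ⟨i, h, hx⟩ => hx ▸ h, fun h => ⟨⟨x, by omega⟩, h, rfl⟩⟩

theorem sum_ite_Ico_mul_Ico {a b c d : ℕ} (hab : a ≤ b) (hcd : c ≤ d) (hb : b ≤ m) (hd : d ≤ n) :
    ∑ i : Fin m, ∑ j : Fin n,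
      (if (a ≤ (i : ℕ) ∧ (i : ℕ) < b) ∧ (c ≤ (j : ℕ) ∧ (j : ℕ) < d) then (1 : ℤ) else 0) =
      ((b : ℤ) - a) * ((d : ℤ) - c) := by
  rw [← sum_product', ← natCast_card_filter, univ_product_univ]
  have : (univ : Finset (Fin m × Fin n)).filter (fun x => (a ≤ (x.1 : ℕ) ∧ (x.1 : ℕ) < b) ∧
      (c ≤ (x.2 : ℕ) ∧ (x.2 : ℕ) < d)) =
      (univ.filter fun i : Fin m => a ≤ (i : ℕ) ∧ (i : ℕ) < b) ×ˢ
        (univ.filter fun j : Fin n => c ≤ (j : ℕ) ∧ (j : ℕ) < d) := by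
    ext
    simp
  rw [this, card_product, card_filter_Fin_Ico hb, card_filter_Fin_Ico hd]
  push_cast [hab, hcd]
  rfl

/-- `t_{k,l}` counts the zeros in the leading `k × l` block together with the ones in the
complementary block. -/
theorem structMat_eq_sum {A : Matrix (Fin m) (Fin n) ℕ} (hA : A ∈ ARS R S) {k l : ℕ}
    (hk : k ≤ m) (hl : l ≤ n) :
    structMat R S k l = ∑ i : Fin m, ∑ j : Fin n,
      ((if (i : ℕ) < k ∧ (j : ℕ) < l then 1 - (A i j : ℤ) else 0) +
        if k ≤ (i : ℕ) ∧ l ≤ (j : ℕ) then (A i j : ℤ) else 0) := by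
  have h₁ := sum_ite_Ico_mul_Ico (Nat.zero_le k) (Nat.zero_le l) hk hl
  have h₂ : ∑ j ∈ univ.filter (fun j : Fin n => (j : ℕ) < l), (S j : ℤ) =
      ∑ i : Fin m, ∑ j : Fin n, if (j : ℕ) < l then (A i j : ℤ) else 0 := by
    rw [sum_comm, sum_filter]
    refine sum_congr rfl fun j _ => ?_
    rw [← hA.2.2 j]
    split_ifs <;> simp
  have h₃ : ∑ i ∈ univ.filter (fun i : Fin m => k ≤ (i : ℕ)), (R i : ℤ) =
      ∑ i : Fin m, ∑ j : Fin n, if k ≤ (i : ℕ) then (A i j : ℤ) else 0 := by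
    rw [sum_filter]
    refine sum_congr rfl fun i _ => ?_
    rw [← hA.2.1 i]
    split_ifs <;> simp
  rw [structMat, h₂, h₃]
  simp only [Nat.cast_zero, sub_zero] at h₁
  rw [← h₁]
  simp only [← sum_sub_distrib, ← sum_add_distrib]
  refine sum_congr rfl fun i _ => sum_congr rfl fun j _ => ?_
  split_ifs <;> omega

theorem structMat_le_of_covers {A : Matrix (Fin m) (Fin n) ℕ} (hA : A ∈ ARS R S) {k l : ℕ}
    (h : Covers A (univ.filter fun i : Fin m => (i : ℕ) < k)
      (univ.filter fun j : Fin n => (j : ℕ) < l))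
    {i₁ i₂ j₁ j₂ : ℕ} (hi₁ : i₁ ≤ k) (hi₂ : k + i₂ ≤ m) (hj₁ : j₁ ≤ l) (hj₂ : l + j₂ ≤ n) :
    structMat R S k l ≤ structMat R S i₁ (l + j₂) + structMat R S (k + i₂) j₁ +
      ((k : ℤ) - i₁) * ((l : ℤ) - j₁) := by
  rw [structMat_eq_sum hA (by omega) (by omega), structMat_eq_sum hA (by omega) (by omega),
    structMat_eq_sum hA (by omega) (by omega),
    ← sum_ite_Ico_mul_Ico hi₁ hj₁ (by omega : k ≤ m) (by omega : l ≤ n)]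
  simp only [← sum_add_distrib]
  refine sum_le_sum fun i _ => sum_le_sum fun j _ => ?_
  have h0 : k ≤ (i : ℕ) → l ≤ (j : ℕ) → A i j = 0 := fun hi hj =>
    (hA.1 i j).resolve_right fun h1 => by
      have := h i j h1
      simp only [mem_filter, mem_univ, true_and] at this
      omega
  rcases hA.1 i j with hij | hij <;> rw [hij] at h0 ⊢ <;> split_ifs <;> simp <;> omega

theorem bddBelow_phi (R : Fin m → ℕ) (S : Fin n → ℕ) (k l : ℕ) :
    BddBelow {v : ℤ | ∃ i1 i2 j1 j2 : ℕ,
      i1 ≤ k ∧ k + i2 ≤ m ∧ j1 ≤ l ∧ l + j2 ≤ n ∧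
      v = structMat R S i1 (l + j2) + structMat R S (k + i2) j1
        + ((k : ℤ) - i1) * ((l : ℤ) - j1)} := by
  refine Set.Finite.bddBelow (Set.Finite.subset (Finset.finite_toSet
    ((range (k + 1) ×ˢ range (m + 1) ×ˢ range (l + 1) ×ˢ range (n + 1)).image
      fun x : ℕ × ℕ × ℕ × ℕ => structMat R S x.1 (l + x.2.2.2) +
        structMat R S (k + x.2.1) x.2.2.1 + ((k : ℤ) - x.1) * ((l : ℤ) - x.2.2.1))) ?_)
  rintro v ⟨i1, i2, j1, j2, h₁, h₂, h₃, h₄, rfl⟩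
  simp only [coe_image, Set.mem_image]
  refine ⟨(i1, i2, j1, j2), ?_, rfl⟩
  simp
  omega

/-- `φ_{k,l} = t_{k,l}` says that `t_{k,l}` is a lower bound of the terms defining `φ_{k,l}`. -/
theorem phi_eq_structMat_iff {k l : ℕ} (hk : k ≤ m) (hl : l ≤ n) :
    phi R S k l = structMat R S k l ↔ ∀ i₁ i₂ j₁ j₂ : ℕ, i₁ ≤ k → k + i₂ ≤ m → j₁ ≤ l →
      l + j₂ ≤ n → structMat R S k l ≤ structMat R S i₁ (l + j₂) + structMat R S (k + i₂) j₁ +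
        ((k : ℤ) - i₁) * ((l : ℤ) - j₁) := by
  have hmem : structMat R S k l ∈ {v : ℤ | ∃ i1 i2 j1 j2 : ℕ,
      i1 ≤ k ∧ k + i2 ≤ m ∧ j1 ≤ l ∧ l + j2 ≤ n ∧
      v = structMat R S i1 (l + j2) + structMat R S (k + i2) j1
        + ((k : ℤ) - i1) * ((l : ℤ) - j1)} := by
    refine ⟨k, m - k, 0, 0, le_rfl, by omega, by omega, by omega, ?_⟩
    have h0 : structMat R S m 0 = 0 := by
      rw [structMat, filter_false_of_mem (by simp), filter_false_of_mem (by simp)]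
      simp
    rw [Nat.add_sub_cancel' hk, h0]
    simp
  constructor
  · intro h i₁ i₂ j₁ j₂ h₁ h₂ h₃ h₄
    rw [← h]
    exact csInf_le (bddBelow_phi R S k l) ⟨i₁, i₂, j₁, j₂, h₁, h₂, h₃, h₄, rfl⟩
  · intro h
    refine le_antisymm (csInf_le (bddBelow_phi R S k l) hmem) (le_csInf ⟨_, hmem⟩ ?_)
    rintro v ⟨i₁, i₂, j₁, j₂, h₁, h₂, h₃, h₄, rfl⟩
    exact h i₁ i₂ j₁ j₂ h₁ h₂ h₃ h₄

end StructureMatrix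

section Existence

variable {m n : ℕ} {R : Fin m → ℕ} {S : Fin n → ℕ}

theorem sum_le_sum_of_card_eq {ι : Type*} [DecidableEq ι] {X Z : Finset ι} (f : ι → ℤ)
    (hcard : #X = #Z) (h : ∀ x ∈ X \ Z, ∀ z ∈ Z \ X, f x ≤ f z) :
    ∑ i ∈ X, f i ≤ ∑ i ∈ Z, f i := by
  have hc : #(X \ Z) = #(Z \ X) := card_sdiff_comm hcard
  rw [← sum_inter_add_sum_sdiff X Z, ← sum_inter_add_sum_sdiff Z X, inter_comm Z X]
  refine add_le_add_right ?_ _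
  rcases (Z \ X).eq_empty_or_nonempty with h0 | h0
  · rw [h0, card_empty, card_eq_zero] at hc
    rw [h0, hc]
  obtain ⟨z, hz, hmin⟩ := exists_min_image _ f h0
  calc _ ≤ #(X \ Z) • f z := sum_le_card_nsmul _ _ _ fun x hx => h x hx z hz
    _ = #(Z \ X) • f z := by rw [hc]
    _ ≤ _ := card_nsmul_le_sum _ _ _ hmin

theorem card_le_sub_of_subset_Ico {a b : ℕ} (hb : b ≤ m) {X : Finset (Fin m)}
    (hX : ∀ i ∈ X, a ≤ (i : ℕ) ∧ (i : ℕ) < b) : #X ≤ b - a := by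
  rw [← card_filter_Fin_Ico hb]
  exact card_le_card fun i hi => by simpa using hX i hi

theorem sum_le_sum_leading {f : Fin m → ℤ} (hf : Antitone f) {a b : ℕ} (hab : a ≤ b) (hb : b ≤ m)
    {X : Finset (Fin m)} (hX : ∀ i ∈ X, a ≤ (i : ℕ) ∧ (i : ℕ) < b) :
    ∑ i ∈ X, f i ≤ ∑ i ∈ univ.filter (fun i : Fin m => a ≤ (i : ℕ) ∧ (i : ℕ) < a + #X), f i := by
  have hcX := card_le_sub_of_subset_Ico hb hX
  refine sum_le_sum_of_card_eq f ?_ ?_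
  · rw [card_filter_Fin_Ico (by omega)]
    omega
  · intro x hx z hz
    simp only [mem_sdiff, mem_filter, mem_univ, true_and] at hx hz
    have := hX x hx.1
    exact hf (Fin.le_def.2 (by omega))

theorem sum_trailing_le_sum {f : Fin m → ℤ} (hf : Antitone f) {a b : ℕ} (hab : a ≤ b) (hb : b ≤ m)
    {X : Finset (Fin m)} (hX : ∀ i ∈ X, a ≤ (i : ℕ) ∧ (i : ℕ) < b) :
    ∑ i ∈ univ.filter (fun i : Fin m => b - #X ≤ (i : ℕ) ∧ (i : ℕ) < b), f i ≤ ∑ i ∈ X, f i := by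
  have hcX := card_le_sub_of_subset_Ico hb hX
  refine sum_le_sum_of_card_eq f ?_ ?_
  · rw [card_filter_Fin_Ico (by omega)]
    omega
  · intro x hx z hz
    simp only [mem_sdiff, mem_filter, mem_univ, true_and] at hx hz
    have := hX z hz.1
    exact hf (Fin.le_def.2 (by omega))

theorem sum_Ico_consecutive (f : Fin m → ℤ) {a b c : ℕ} (hab : a ≤ b) (hbc : b ≤ c) :
    ∑ i ∈ univ.filter (fun i : Fin m => a ≤ (i : ℕ) ∧ (i : ℕ) < b), f i +
      ∑ i ∈ univ.filter (fun i : Fin m => b ≤ (i : ℕ) ∧ (i : ℕ) < c), f i =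
    ∑ i ∈ univ.filter (fun i : Fin m => a ≤ (i : ℕ) ∧ (i : ℕ) < c), f i := by
  simp only [sum_filter, ← sum_add_distrib]
  refine sum_congr rfl fun i _ => ?_
  split_ifs <;> omega

theorem structMat_eq_Ico (R : Fin m → ℕ) (S : Fin n → ℕ) (k l : ℕ) :
    structMat R S k l = (k : ℤ) * l -
      ∑ j ∈ univ.filter (fun j : Fin n => 0 ≤ (j : ℕ) ∧ (j : ℕ) < l), (S j : ℤ) +
      ∑ i ∈ univ.filter (fun i : Fin m => k ≤ (i : ℕ) ∧ (i : ℕ) < m), (R i : ℤ) := by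
  simp [structMat]

/-- The edges of the complement of the trailing block. -/
def blockGraph (m n k l : ℕ) : Finset (Fin m × Fin n) :=
  univ.filter fun p => (p.1 : ℕ) < k ∨ (p.2 : ℕ) < l

theorem card_blockGraph_cut {k l : ℕ} (hl : l ≤ n) (X : Finset (Fin m))
    (Y : Finset (Fin n)) :
    (#((blockGraph m n k l).filter fun p => p.1 ∈ X ∧ p.2 ∉ Y) : ℤ) =
      #(X.filter fun i : Fin m => (i : ℕ) < k) * ((n : ℤ) - #Y) +
      #(X.filter fun i : Fin m => ¬ (i : ℕ) < k) * ((l : ℤ) - #(Y.filter fun j : Fin n => (j : ℕ) < l)) := by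
  have hsplit : (blockGraph m n k l).filter (fun p => p.1 ∈ X ∧ p.2 ∉ Y) =
      ((X.filter fun i : Fin m => (i : ℕ) < k) ×ˢ Yᶜ) ∪
      ((X.filter fun i : Fin m => ¬ (i : ℕ) < k) ×ˢ
        ((univ.filter fun j : Fin n => 0 ≤ (j : ℕ) ∧ (j : ℕ) < l) \
          (Y.filter fun j : Fin n => (j : ℕ) < l))) := by
    ext p
    simp only [blockGraph, mem_filter, mem_univ, mem_union, mem_product, mem_compl, mem_sdiff]
    grind
  have hd : Disjoint ((X.filter fun i : Fin m => (i : ℕ) < k) ×ˢ Yᶜ)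
      ((X.filter fun i : Fin m => ¬ (i : ℕ) < k) ×ˢ
        ((univ.filter fun j : Fin n => 0 ≤ (j : ℕ) ∧ (j : ℕ) < l) \
          (Y.filter fun j : Fin n => (j : ℕ) < l))) := by
    rw [Finset.disjoint_left]
    intro p hp hq
    simp only [mem_product, mem_filter] at hp hq
    exact hq.1.2 hp.1.2
  have hsub : (Y.filter fun j : Fin n => (j : ℕ) < l) ⊆
      univ.filter fun j : Fin n => 0 ≤ (j : ℕ) ∧ (j : ℕ) < l := by
    intro j hj
    simpa using (mem_filter.1 hj).2
  have h₁ := card_le_card hsub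
  rw [card_filter_Fin_Ico hl] at h₁
  have h₂ := card_le_univ Y
  rw [Fintype.card_fin] at h₂
  rw [hsplit, card_union_of_disjoint hd, card_product, card_product, card_compl,
    card_sdiff_of_subset hsub, card_filter_Fin_Ico hl, Fintype.card_fin]
  push_cast [h₁, h₂]
  simp

theorem cut_condition_of_structMat_le (hR : Antitone R) (hS : Antitone S)
    (hRS : ∑ i, R i = ∑ j, S j) {k l : ℕ} (hk : k ≤ m) (hl : l ≤ n)
    (h : ∀ i₁ i₂ j₁ j₂ : ℕ, i₁ ≤ k → k + i₂ ≤ m → j₁ ≤ l →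
      l + j₂ ≤ n → structMat R S k l ≤ structMat R S i₁ (l + j₂) + structMat R S (k + i₂) j₁ +
        ((k : ℤ) - i₁) * ((l : ℤ) - j₁)) (X : Finset (Fin m)) (Y : Finset (Fin n)) :
    ∑ i ∈ X, (R i : ℤ) ≤ ∑ j ∈ Y, (S j : ℤ) +
      #((blockGraph m n k l).filter fun p => p.1 ∈ X ∧ p.2 ∉ Y) := by
  have hR' : Antitone fun i => (R i : ℤ) := fun i j hij => Nat.cast_le.2 (hR hij)
  have hS' : Antitone fun i => (S i : ℤ) := fun i j hij => Nat.cast_le.2 (hS hij)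
  rw [card_blockGraph_cut hl, ← sum_filter_add_sum_filter_not X (fun i => (i : ℕ) < k),
    ← sum_filter_add_sum_filter_not Y (fun j => (j : ℕ) < l),
    ← card_filter_add_card_filter_not (s := Y) (fun j => (j : ℕ) < l)]
  have hX₁ : ∀ i ∈ X.filter (fun i : Fin m => (i : ℕ) < k), 0 ≤ (i : ℕ) ∧ (i : ℕ) < k := by simp
  have hX₂ : ∀ i ∈ X.filter (fun i : Fin m => ¬ (i : ℕ) < k), k ≤ (i : ℕ) ∧ (i : ℕ) < m := by simp
  have hY₁ : ∀ i ∈ Y.filter (fun i : Fin n => (i : ℕ) < l), 0 ≤ (i : ℕ) ∧ (i : ℕ) < l := by simp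
  have hY₂ : ∀ i ∈ Y.filter (fun i : Fin n => ¬ (i : ℕ) < l), l ≤ (i : ℕ) ∧ (i : ℕ) < n := by simp
  have ha := card_le_sub_of_subset_Ico hk hX₁
  have hb := card_le_sub_of_subset_Ico le_rfl hX₂
  have hc := card_le_sub_of_subset_Ico hl hY₁
  have hd := card_le_sub_of_subset_Ico le_rfl hY₂
  have sa := sum_le_sum_leading hR' (Nat.zero_le k) hk hX₁
  have sb := sum_le_sum_leading hR' hk le_rfl hX₂
  have sc := sum_trailing_le_sum hS' (Nat.zero_le l) hl hY₁
  have sd := sum_trailing_le_sum hS' hl le_rfl hY₂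
  generalize #(X.filter fun i : Fin m => (i : ℕ) < k) = a at *
  generalize #(X.filter fun i : Fin m => ¬ (i : ℕ) < k) = b at *
  generalize #(Y.filter fun i : Fin n => (i : ℕ) < l) = c at *
  generalize #(Y.filter fun i : Fin n => ¬ (i : ℕ) < l) = d at *
  have key := h a b (l - c) (n - l - d) (by omega) (by omega) (by omega) (by omega)
  have htot : ∑ i ∈ univ.filter (fun i : Fin m => 0 ≤ (i : ℕ) ∧ (i : ℕ) < m), (R i : ℤ) =
      ∑ j ∈ univ.filter (fun j : Fin n => 0 ≤ (j : ℕ) ∧ (j : ℕ) < n), (S j : ℤ) := by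
    simp only [Nat.zero_le, Fin.is_lt, and_self, filter_true]
    exact_mod_cast hRS
  have hld : l + (n - l - d) = n - d := by omega
  rw [hld] at key
  simp only [structMat_eq_Ico] at key
  have r₁ := sum_Ico_consecutive (fun i => (R i : ℤ)) (Nat.zero_le a) (by omega : a ≤ m)
  have r₂ := sum_Ico_consecutive (fun i => (R i : ℤ)) (by omega : k ≤ k + b) (by omega : k + b ≤ m)
  have s₁ := sum_Ico_consecutive (fun j => (S j : ℤ)) (Nat.zero_le (l - c)) (by omega : l - c ≤ l)
  have s₂ := sum_Ico_consecutive (fun j => (S j : ℤ)) (Nat.zero_le (n - d)) (by omega : n - d ≤ n)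
  have hcast₁ : ((l - c : ℕ) : ℤ) = l - c := by omega
  have hcast₂ : ((n - d : ℕ) : ℤ) = n - d := by omega
  rw [hcast₁, hcast₂] at key
  rw [zero_add] at sa
  push_cast at key ⊢
  linarith

theorem exists_covers_of_structMat_le (hR : Antitone R) (hS : Antitone S)
    (hRS : ∑ i, R i = ∑ j, S j) {k l : ℕ} (hk : k ≤ m) (hl : l ≤ n)
    (h : ∀ i₁ i₂ j₁ j₂ : ℕ, i₁ ≤ k → k + i₂ ≤ m → j₁ ≤ l →
      l + j₂ ≤ n → structMat R S k l ≤ structMat R S i₁ (l + j₂) + structMat R S (k + i₂) j₁ +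
        ((k : ℤ) - i₁) * ((l : ℤ) - j₁)) :
    ∃ A ∈ ARS R S, Covers A (univ.filter fun i : Fin m => (i : ℕ) < k)
      (univ.filter fun j : Fin n => (j : ℕ) < l) := by
  obtain ⟨P, hP, hr, hs⟩ := exists_subgraph_of_cut_condition (blockGraph m n k l)
    (fun i => (R i : ℤ)) (fun j => (S j : ℤ)) (by exact_mod_cast hRS)
    (cut_condition_of_structMat_le hR hS hRS hk hl h)
  refine ⟨fun i j => if (i, j) ∈ P then 1 else 0, ⟨?_, ?_, ?_⟩, ?_⟩
  · intro i j
    dsimp only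
    split_ifs <;> simp
  · intro i
    rw [← card_filter, ← Nat.cast_inj (R := ℤ), ← hr i, Nat.cast_inj]
    refine card_bij (fun j _ => (i, j)) ?_ ?_ ?_
    · simp
    · simp
    · rintro ⟨i', j⟩ hp
      obtain ⟨hp, rfl⟩ := mem_filter.1 hp
      exact ⟨j, by simpa using hp, rfl⟩
  · intro j
    rw [← card_filter, ← Nat.cast_inj (R := ℤ), ← hs j, Nat.cast_inj]
    refine card_bij (fun i _ => (i, j)) ?_ ?_ ?_
    · simp
    · simp
    · rintro ⟨i, j'⟩ hp
      obtain ⟨hp, rfl⟩ := mem_filter.1 hp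
      exact ⟨i, by simpa using hp, rfl⟩
  · intro i j hij
    have hmem : (i, j) ∈ P := by
      by_contra hmem
      simp [hmem] at hij
    simpa [blockGraph] using hP hmem

end Existence

/-- The minimum `t`-term rank over a nonempty class `𝒜(R,S)` equals
`min { t·e + f : 0 ≤ e ≤ m, 0 ≤ f ≤ n, φ_{e,f} = t_{e,f} }`. -/
theorem minTermRank_eq {m n : ℕ} (R : Fin m → ℕ) (S : Fin n → ℕ)
    (hRS : IsPartitionPair R S) (hne : (ARS R S).Nonempty)
    (t : ℕ) (ht : 0 < t) :
    minTermRank t R S =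
      sInf {v : ℕ | ∃ e f : ℕ, e ≤ m ∧ f ≤ n ∧
        phi R S e f = structMat R S e f ∧ v = t * e + f} := by
  obtain ⟨hR, -, hS, -, hsum⟩ := hRS
  have hmem : ∀ A ∈ ARS R S, tTermRank t A ∈ {v : ℕ | ∃ e f : ℕ, e ≤ m ∧ f ≤ n ∧
      phi R S e f = structMat R S e f ∧ v = t * e + f} := by
    intro A hA
    obtain ⟨E, F, hcov, hEF⟩ := exists_covers_eq_tTermRank t A
    have hE : #E ≤ m := by simpa using card_le_univ E
    have hF : #F ≤ n := by simpa using card_le_univ F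
    obtain ⟨B, hB, hBcov⟩ := exists_covers_initial hR hS hA hcov
    exact ⟨#E, #F, hE, hF, (phi_eq_structMat_iff hE hF).2
      fun _ _ _ _ h₁ h₂ h₃ h₄ => structMat_le_of_covers hB hBcov h₁ h₂ h₃ h₄, hEF.symm⟩
  obtain ⟨A₀, hA₀⟩ := hne
  apply le_antisymm
  · obtain ⟨e, f, he, hf, hphi, hv⟩ := Nat.sInf_mem (Set.nonempty_of_mem (hmem A₀ hA₀))
    rw [hv]
    obtain ⟨A, hA, hcov⟩ := exists_covers_of_structMat_le hR hS hsum he hf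
      ((phi_eq_structMat_iff he hf).1 hphi)
    have hle : minTermRank t R S ≤ tTermRank t A := Nat.sInf_le ⟨A, hA, rfl⟩
    refine hle.trans ((tTermRank_le_of_covers hcov).trans_eq ?_)
    have hcE := card_filter_Fin_Ico (a := 0) he
    have hcF := card_filter_Fin_Ico (a := 0) hf
    simp only [Nat.zero_le, true_and, Nat.sub_zero] at hcE hcF
    rw [hcE, hcF]
  · obtain ⟨A, hA, hr⟩ : minTermRank t R S ∈ {r : ℕ | ∃ A ∈ ARS R S, tTermRank t A = r} :=
      Nat.sInf_mem ⟨_, A₀, hA₀, rfl⟩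
    rw [← hr]
    exact Nat.sInf_le (hmem A hA)
end

section
/- Let R=(R_1,…,R_m) and S=(S_1,…,S_n) be partitions of the same weight such that A(R,S) is nonempty, and let e, e′, f, f′ be integers with 0 ≤ e′ < e ≤ m and 0 ≤ f < f′ ≤ n. Then there exists a matrix A ∈ A(R,S) such that a_{i,j} = 0 whenever (i > e′ and j > f′) or (i > e and j > f) — i.e., A has a zero block in rows e′+1,…,e and columns f′+1,…,n, and a zero block in rows e+1,…,m and columns f+1,…,n — if and only if ψ_{e′,e;f,f′} ≥ t_{e,f} + t_{e′,f′}. -/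
open Finset

/-- The sum of the first `k` parts of `R`. -/
def prefixSum {m : ℕ} (R : Fin m → ℕ) (k : ℕ) : ℕ :=
  ∑ i ∈ Finset.univ.filter (fun i : Fin m => (i : ℕ) < k), R i

theorem prefixSum_succ {m : ℕ} (R : Fin m → ℕ) {k : ℕ} (hk : k < m) :
    prefixSum R (k + 1) = prefixSum R k + R ⟨k, hk⟩ := by
  have h : (univ.filter fun i : Fin m => (i : ℕ) < k + 1) =
      insert ⟨k, hk⟩ (univ.filter fun i : Fin m => (i : ℕ) < k) := by
    ext i
    simp only [mem_filter, mem_univ, true_and, mem_insert, Fin.ext_iff]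
    omega
  rw [prefixSum, h, sum_insert (by simp), prefixSum, add_comm]

theorem prefixSum_add_sum_Ico {m : ℕ} (R : Fin m → ℕ) (a k : ℕ) :
    prefixSum R a + ∑ i ∈ univ.filter (fun i : Fin m => a ≤ (i : ℕ) ∧ (i : ℕ) < a + k), R i =
      prefixSum R (a + k) := by
  rw [prefixSum, prefixSum, ← sum_union]
  · congr 1
    ext i
    simp only [mem_filter, mem_univ, true_and, mem_union]
    omega
  · rw [disjoint_left]
    intro i
    simp only [mem_filter, mem_univ, true_and]
    omega

theorem prefixSum_add_sum_ge {m : ℕ} (R : Fin m → ℕ) (k : ℕ) :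
    prefixSum R k + ∑ i ∈ univ.filter (fun i : Fin m => k ≤ (i : ℕ)), R i = ∑ i, R i := by
  rw [prefixSum, ← sum_filter_add_sum_filter_not univ (fun i : Fin m => (i : ℕ) < k)]
  simp only [not_lt]

theorem card_filter_Ico {m a k : ℕ} (h : a + k ≤ m) :
    (univ.filter (fun i : Fin m => a ≤ (i : ℕ) ∧ (i : ℕ) < a + k)).card = k := by
  have h0 : ∀ b ≤ m, prefixSum (fun _ : Fin m => 1) b = b := by
    intro b hb
    induction b with
    | zero => simp [prefixSum]
    | succ b ih => rw [prefixSum_succ _ hb, ih (by omega)]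
  have h1 := prefixSum_add_sum_Ico (fun _ : Fin m => 1) a k
  rw [h0 _ h, h0 a (by omega), sum_const, smul_eq_mul, mul_one] at h1
  omega

theorem add_card_le_of_forall_mem_Ico {m a b : ℕ} (hab : a ≤ b) (hb : b ≤ m)
    {X : Finset (Fin m)} (hX : ∀ i ∈ X, a ≤ (i : ℕ) ∧ (i : ℕ) < b) : a + X.card ≤ b := by
  have h := card_le_card (s := X)
    (t := univ.filter fun i : Fin m => a ≤ (i : ℕ) ∧ (i : ℕ) < a + (b - a)) (by
      intro i hi
      have := hX i hi
      simp only [mem_filter, mem_univ, true_and]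
      omega)
  rw [card_filter_Ico (by omega)] at h
  omega

/-- Among the sets of indices `≥ a` of given size, the interval starting at `a` has the largest
sum of a nonincreasing sequence. -/
theorem prefixSum_add_sum_le {m : ℕ} {R : Fin m → ℕ} (hR : Antitone R) {a : ℕ}
    (X : Finset (Fin m)) (hX : ∀ i ∈ X, a ≤ (i : ℕ)) :
    prefixSum R a + ∑ i ∈ X, R i ≤ prefixSum R (a + X.card) := by
  induction X using Finset.induction_on_max with
  | empty => simp
  | insert x s hx ih =>
    have hxs : x ∉ s := fun h => lt_irrefl _ (hx x h)
    have hs : ∀ i ∈ s, a ≤ (i : ℕ) := fun i hi => hX i (mem_insert_of_mem hi)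
    have hax := hX x (mem_insert_self x s)
    have hcard : a + s.card ≤ (x : ℕ) :=
      add_card_le_of_forall_mem_Ico hax x.isLt.le fun i hi => ⟨hs i hi, hx i hi⟩
    have hlt : a + s.card < m := hcard.trans_lt x.isLt
    have hRx : R x ≤ R ⟨a + s.card, hlt⟩ := hR hcard
    rw [sum_insert hxs, card_insert_of_notMem hxs, ← add_assoc a, prefixSum_succ R hlt]
    have := ih hs
    omega

theorem structMat_eq {m n : ℕ} (R : Fin m → ℕ) (S : Fin n → ℕ) (k l : ℕ) :
    structMat R S k l =
      (k : ℤ) * l - prefixSum S l + ((∑ i, R i : ℕ) - prefixSum R k) := by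
  rw [← prefixSum_add_sum_ge R k, structMat, prefixSum, prefixSum]
  push_cast
  ring

/-- A `(0,1)`-matrix with prescribed line sums and support inside `C` exists if every choice of
rows `X` and columns `Y` satisfies the cut inequality. -/
theorem exists_mem_ARS_of_cut {m n : ℕ} (R : Fin m → ℕ) (S : Fin n → ℕ)
    (hsum : ∑ i, R i = ∑ j, S j) (C : Finset (Fin m × Fin n))
    (hcut : ∀ X Y, ∑ i ∈ X, R i ≤ (C ∩ X ×ˢ Y).card + ∑ j ∈ Yᶜ, S j) :
    ∃ A ∈ ARS R S, ∀ i j, (i, j) ∉ C → A i j = 0 := by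
  classical
  let t : (Σ i : Fin m, Fin (R i)) ⊕ (Fin m × Fin n) →
      Finset ((Fin m × Fin n) ⊕ (Σ j : Fin n, Fin (S j))) :=
    Sum.elim (fun p => (C.filter fun c => c.1 = p.1).disjSum ∅)
      (fun c => ({c} : Finset _).disjSum (univ.filter fun q => q.1 = c.2))
  have hall : ∀ s : Finset _, s.card ≤ (s.biUnion t).card := by
    intro s
    set A₁ := s.toLeft
    set A₂ := s.toRight
    set X : Finset (Fin m) := A₁.image Sigma.fst
    set Z : Finset (Fin n) := A₂.image Prod.snd
    have hA₁ : A₁.card ≤ ∑ i ∈ X, R i := by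
      calc A₁.card ≤ (X.sigma fun i => (univ : Finset (Fin (R i)))).card := by
            apply card_le_card
            intro p hp
            simp only [mem_sigma, mem_univ, and_true]
            exact mem_image_of_mem _ hp
        _ = _ := by simp
    have hsub : ((C ∩ X ×ˢ Zᶜ) ∪ A₂).disjSum (Z.sigma fun j => (univ : Finset (Fin (S j))))
        ⊆ s.biUnion t := by
      intro y hy
      rw [mem_biUnion]
      rcases y with c | q
      · rw [inl_mem_disjSum, mem_union] at hy
        rcases hy with hy | hy
        · simp only [mem_inter, mem_product] at hy
          obtain ⟨p, hp, hpc⟩ := mem_image.1 hy.2.1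
          exact ⟨Sum.inl p, mem_toLeft.1 hp, by simp [t, hy.1, hpc]⟩
        · exact ⟨Sum.inr c, mem_toRight.1 hy, by simp [t]⟩
      · rw [inr_mem_disjSum, mem_sigma] at hy
        obtain ⟨c, hc, hcq⟩ := mem_image.1 hy.1
        exact ⟨Sum.inr c, mem_toRight.1 hc, by simp [t, hcq]⟩
    have hdisj : Disjoint (C ∩ X ×ˢ Zᶜ) A₂ := by
      rw [disjoint_left]
      intro c hc hc2
      simp only [mem_inter, mem_product, mem_compl] at hc
      exact hc.2.2 (mem_image_of_mem _ hc2)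
    have h := card_le_card hsub
    rw [card_disjSum, card_union_of_disjoint hdisj, card_sigma] at h
    simp only [card_univ, Fintype.card_fin] at h
    have hc := hcut X Zᶜ
    rw [compl_compl] at hc
    have hs : A₁.card + A₂.card = s.card := card_toLeft_add_card_toRight
    omega
  obtain ⟨g, hg, hgt⟩ := (all_card_le_biUnion_card_iff_exists_injective t).1 hall
  have hrow : ∀ p, ∃ c ∈ C, c.1 = p.1 ∧ g (Sum.inl p) = Sum.inl c := by
    intro p
    have h := hgt (Sum.inl p)
    rcases hgp : g (Sum.inl p) with c | q
    · rw [hgp] at h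
      simp only [t, Sum.elim_inl, inl_mem_disjSum, mem_filter] at h
      exact ⟨c, h.1, h.2, rfl⟩
    · rw [hgp] at h
      simp [t] at h
  choose φ hφC hφ hφg using hrow
  have hφinj : Function.Injective φ := by
    intro p q hpq
    have : g (Sum.inl p) = g (Sum.inl q) := by rw [hφg, hφg, hpq]
    exact Sum.inl_injective (hg this)
  set P : Finset (Fin m × Fin n) := univ.image φ
  have hcol : ∀ c ∈ P, ∃ q : (Σ j : Fin n, Fin (S j)), q.1 = c.2 ∧
      g (Sum.inr c) = Sum.inr q := by
    intro c hc
    have h := hgt (Sum.inr c)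
    rcases hgc : g (Sum.inr c) with d | q
    · rw [hgc] at h
      simp only [t, Sum.elim_inr, inl_mem_disjSum, mem_singleton] at h
      obtain ⟨p, -, hp⟩ := mem_image.1 hc
      have : g (Sum.inr c) = g (Sum.inl p) := by rw [hgc, hφg, hp, h]
      exact absurd (hg this) (by simp)
    · rw [hgc] at h
      simp only [t, Sum.elim_inr, inr_mem_disjSum, mem_filter] at h
      exact ⟨q, h.2, rfl⟩
  let A : Matrix (Fin m) (Fin n) ℕ := fun i j => if (i, j) ∈ P then 1 else 0
  have hAr : ∀ i, ∑ j, A i j = R i := by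
    intro i
    have h1 : ∑ j, A i j = (univ.filter fun j => (i, j) ∈ P).card := by
      simp [A]
    have h2 : (univ.filter fun j => (i, j) ∈ P) =
        (univ : Finset (Fin (R i))).image fun a => (φ ⟨i, a⟩).2 := by
      ext j
      simp only [mem_filter, mem_univ, true_and, mem_image, P]
      constructor
      · rintro ⟨p, hp⟩
        have hi : p.1 = i := by rw [← hφ, hp]
        obtain ⟨i', a⟩ := p
        obtain rfl : i' = i := hi
        exact ⟨a, by rw [hp]⟩
      · rintro ⟨a, ha⟩
        exact ⟨⟨i, a⟩, Prod.ext (hφ _) ha⟩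
    rw [h1, h2, card_image_of_injective, card_univ, Fintype.card_fin]
    intro a b hab
    have : φ ⟨i, a⟩ = φ ⟨i, b⟩ := Prod.ext ((hφ ⟨i, a⟩).trans (hφ ⟨i, b⟩).symm) hab
    simpa using hφinj this
  have hAc_le : ∀ j, ∑ i, A i j ≤ S j := by
    intro j
    have h1 : ∑ i, A i j = (univ.filter fun i => (i, j) ∈ P).card := by
      simp [A]
    have h2 : ((univ.filter fun i => (i, j) ∈ P).image fun i => g (Sum.inr (i, j))) ⊆
        (univ : Finset (Fin (S j))).image fun a => Sum.inr ⟨j, a⟩ := by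
      intro y hy
      obtain ⟨i, hi, rfl⟩ := mem_image.1 hy
      obtain ⟨⟨j', a⟩, hq, hgq⟩ := hcol (i, j) (mem_filter.1 hi).2
      obtain rfl : j' = j := hq
      exact mem_image.2 ⟨a, mem_univ _, hgq.symm⟩
    have h3 := (card_le_card h2).trans card_image_le
    rw [card_image_of_injective, card_univ, Fintype.card_fin] at h3
    · rw [h1]
      exact h3
    · intro a b hab
      simpa using hg hab
  have hAc : ∀ j, ∑ i, A i j = S j := by
    have h : ∑ j, ∑ i, A i j = ∑ j, S j := by
      rw [sum_comm, ← hsum]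
      exact sum_congr rfl fun i _ => hAr i
    intro j
    exact (sum_eq_sum_iff_of_le fun j _ => hAc_le j).1 h j (mem_univ j)
  refine ⟨A, ⟨fun i j => ?_, hAr, hAc⟩, fun i j hij => ?_⟩
  · by_cases h : (i, j) ∈ P <;> simp [A, h]
  · refine if_neg fun h => hij ?_
    obtain ⟨p, -, hp⟩ := mem_image.1 h
    rw [← hp]
    exact hφC p

theorem sum_le_card_inter_add_sum_compl {m n : ℕ} {R : Fin m → ℕ} {S : Fin n → ℕ}
    {C : Finset (Fin m × Fin n)} {A : Fin m → Fin n → ℕ} (h01 : ∀ i j, A i j = 0 ∨ A i j = 1)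
    (hr : ∀ i, ∑ j, A i j = R i) (hc : ∀ j, ∑ i, A i j = S j)
    (hC : ∀ i j, (i, j) ∉ C → A i j = 0) (X : Finset (Fin m)) (Y : Finset (Fin n)) :
    ∑ i ∈ X, R i ≤ (C ∩ X ×ˢ Y).card + ∑ j ∈ Yᶜ, S j := by
  have h1 : ∑ i ∈ X, R i = ∑ i ∈ X, ∑ j ∈ Y, A i j + ∑ i ∈ X, ∑ j ∈ Yᶜ, A i j := by
    rw [← sum_add_distrib]
    exact sum_congr rfl fun i _ => by rw [← hr i, sum_add_sum_compl]
  have h2 : ∑ i ∈ X, ∑ j ∈ Yᶜ, A i j ≤ ∑ j ∈ Yᶜ, S j := by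
    rw [sum_comm]
    refine sum_le_sum fun j _ => ?_
    rw [← hc j]
    exact sum_le_sum_of_subset (subset_univ X)
  have h3 : ∑ i ∈ X, ∑ j ∈ Y, A i j ≤ (C ∩ X ×ˢ Y).card := by
    rw [← sum_product', inter_comm, ← filter_mem_eq_inter, card_filter]
    refine sum_le_sum fun c _ => ?_
    split_ifs with h
    · rcases h01 c.1 c.2 with h | h <;> omega
    · exact (hC c.1 c.2 h).le
  omega

theorem sum_eq_sum_three_blocks {m : ℕ} (g : Fin m → ℕ) {a b : ℕ} (hab : a ≤ b)
    (X : Finset (Fin m)) :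
    ∑ i ∈ X, g i = ∑ i ∈ X.filter (fun i : Fin m => (i : ℕ) < a), g i +
      ∑ i ∈ X.filter (fun i : Fin m => a ≤ (i : ℕ) ∧ (i : ℕ) < b), g i +
      ∑ i ∈ X.filter (fun i : Fin m => b ≤ (i : ℕ)), g i := by
  simp only [sum_filter, ← sum_add_distrib]
  refine sum_congr rfl fun i _ => ?_
  split_ifs <;> omega

/-- The positions outside the two zero blocks. -/
def staircase (m n e e' f f' : ℕ) : Finset (Fin m × Fin n) :=
  univ.filter fun c => ¬ ((e' ≤ (c.1 : ℕ) ∧ f' ≤ (c.2 : ℕ)) ∨ (e ≤ (c.1 : ℕ) ∧ f ≤ (c.2 : ℕ)))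

theorem card_staircase_inter {m n e e' f f' : ℕ} (he : e' ≤ e) (hf : f ≤ f')
    (X : Finset (Fin m)) (Y : Finset (Fin n)) :
    (staircase m n e e' f f' ∩ X ×ˢ Y).card =
      (X.filter fun i : Fin m => (i : ℕ) < e').card * ((Y.filter fun j : Fin n => (j : ℕ) < f).card +
        (Y.filter fun j : Fin n => f ≤ (j : ℕ) ∧ (j : ℕ) < f').card +
        (Y.filter fun j : Fin n => f' ≤ (j : ℕ)).card) +
      (X.filter fun i : Fin m => e' ≤ (i : ℕ) ∧ (i : ℕ) < e).card *
        ((Y.filter fun j : Fin n => (j : ℕ) < f).card +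
          (Y.filter fun j : Fin n => f ≤ (j : ℕ) ∧ (j : ℕ) < f').card) +
      (X.filter fun i : Fin m => e ≤ (i : ℕ)).card * (Y.filter fun j : Fin n => (j : ℕ) < f).card := by
  have h0 : (staircase m n e e' f f' ∩ X ×ˢ Y).card = ∑ i ∈ X, ∑ j ∈ Y,
      if ¬ ((e' ≤ (i : ℕ) ∧ f' ≤ (j : ℕ)) ∨ (e ≤ (i : ℕ) ∧ f ≤ (j : ℕ))) then 1 else 0 := by
    rw [← sum_product', inter_comm, ← filter_mem_eq_inter, card_filter]
    simp [staircase]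
  rw [h0, sum_eq_sum_three_blocks _ he X]
  simp only [card_eq_sum_ones (X.filter _), sum_mul, one_mul]
  congr 1
  · congr 1
    all_goals
      refine sum_congr rfl fun i hi => ?_
      have hi := (mem_filter.1 hi).2
      simp only [card_filter, ← sum_add_distrib]
      refine sum_congr rfl fun j _ => ?_
      split_ifs <;> omega
  · refine sum_congr rfl fun i hi => ?_
    have hi := (mem_filter.1 hi).2
    simp only [card_filter]
    refine sum_congr rfl fun j _ => ?_
    split_ifs <;> omega

/-- The expression minimized in `psi`. -/
def psiTerm {m n : ℕ} (R : Fin m → ℕ) (S : Fin n → ℕ) (a b c d i1 i2 i3 j1 j2 j3 : ℕ) : ℤ :=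
  structMat R S i1 (d + j3) + structMat R S (a + i2) (c + j2) + structMat R S (b + i3) j1
    + ((a : ℤ) - i1) * ((d : ℤ) - (c : ℤ) - j2)
    + ((b : ℤ) - (a : ℤ) - i2) * ((c : ℤ) - j1)
    + ((a : ℤ) - i1) * ((c : ℤ) - j1)

theorem le_psi_iff {m n : ℕ} (R : Fin m → ℕ) (S : Fin n → ℕ) {a b c d : ℕ}
    (hab : a ≤ b) (hb : b ≤ m) (hcd : c ≤ d) (hd : d ≤ n) (v : ℤ) :
    v ≤ psi R S a b c d ↔ ∀ i1 i2 i3 j1 j2 j3 : ℕ, i1 ≤ a → a + i2 ≤ b → b + i3 ≤ m →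
      j1 ≤ c → c + j2 ≤ d → d + j3 ≤ n → v ≤ psiTerm R S a b c d i1 i2 i3 j1 j2 j3 := by
  have hbdd : BddBelow {v : ℤ | ∃ i1 i2 i3 j1 j2 j3 : ℕ,
      i1 ≤ a ∧ a + i2 ≤ b ∧ b + i3 ≤ m ∧ j1 ≤ c ∧ c + j2 ≤ d ∧ d + j3 ≤ n ∧
      v = psiTerm R S a b c d i1 i2 i3 j1 j2 j3} := by
    have ht : ∀ k l, -(∑ j, S j : ℕ) ≤ structMat R S k l := by
      intro k l
      rw [structMat_eq]
      have h1 := prefixSum_add_sum_ge R k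
      have h2 := prefixSum_add_sum_ge S l
      have h3 : (0 : ℤ) ≤ (k : ℤ) * l := by positivity
      omega
    refine ⟨-3 * (∑ j, S j : ℕ), ?_⟩
    rintro _ ⟨i1, i2, i3, j1, j2, j3, p1, p2, p3, q1, q2, q3, rfl⟩
    have k1 := ht i1 (d + j3)
    have k2 := ht (a + i2) (c + j2)
    have k3 := ht (b + i3) j1
    have l1 : 0 ≤ ((a : ℤ) - i1) * ((d : ℤ) - (c : ℤ) - j2) :=
      mul_nonneg (by omega) (by omega)
    have l2 : 0 ≤ ((b : ℤ) - (a : ℤ) - i2) * ((c : ℤ) - j1) :=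
      mul_nonneg (by omega) (by omega)
    have l3 : 0 ≤ ((a : ℤ) - i1) * ((c : ℤ) - j1) := mul_nonneg (by omega) (by omega)
    unfold psiTerm
    linarith
  have hne : {v : ℤ | ∃ i1 i2 i3 j1 j2 j3 : ℕ,
      i1 ≤ a ∧ a + i2 ≤ b ∧ b + i3 ≤ m ∧ j1 ≤ c ∧ c + j2 ≤ d ∧ d + j3 ≤ n ∧
      v = psiTerm R S a b c d i1 i2 i3 j1 j2 j3}.Nonempty :=
    ⟨_, 0, 0, 0, 0, 0, 0, by omega, by omega, by omega, by omega, by omega, by omega, rfl⟩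
  refine (le_csInf_iff hbdd hne).trans ⟨?_, ?_⟩
  · intro h i1 i2 i3 j1 j2 j3 p1 p2 p3 q1 q2 q3
    exact h _ ⟨i1, i2, i3, j1, j2, j3, p1, p2, p3, q1, q2, q3, rfl⟩
  · rintro h _ ⟨i1, i2, i3, j1, j2, j3, p1, p2, p3, q1, q2, q3, rfl⟩
    exact h i1 i2 i3 j1 j2 j3 p1 p2 p3 q1 q2 q3

theorem structMat_add_le_psiTerm_iff {m n : ℕ} (R : Fin m → ℕ) (S : Fin n → ℕ)
    (a b c d i1 i2 i3 j1 j2 j3 : ℕ) :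
    structMat R S b c + structMat R S a d ≤ psiTerm R S a b c d i1 i2 i3 j1 j2 j3 ↔
      prefixSum R i1 + prefixSum R (a + i2) + prefixSum R (b + i3) +
          (prefixSum S j1 + prefixSum S (c + j2) + prefixSum S (d + j3)) ≤
        ∑ i, R i + (i1 * (j1 + j2 + j3) + i2 * (j1 + j2) + i3 * j1) +
          (prefixSum R a + prefixSum R b + prefixSum S c + prefixSum S d) := by
  simp only [psiTerm, structMat_eq]
  zify
  constructor <;> intro h <;> linarith

/-- The union of initial segments, of sizes `k1`, `k2` and `k3`, of the three intervals into
which the indices are cut by `a` and `b`. -/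
def blockPrefixes (m a b k1 k2 k3 : ℕ) : Finset (Fin m) :=
  univ.filter fun i => (i : ℕ) < k1 ∨ (a ≤ (i : ℕ) ∧ (i : ℕ) < a + k2) ∨
    (b ≤ (i : ℕ) ∧ (i : ℕ) < b + k3)

theorem filter_blockPrefixes {m a b k1 k2 k3 : ℕ} (h1 : k1 ≤ a) (h2 : a + k2 ≤ b) :
    (blockPrefixes m a b k1 k2 k3).filter (fun i : Fin m => (i : ℕ) < a) =
        univ.filter (fun i : Fin m => 0 ≤ (i : ℕ) ∧ (i : ℕ) < 0 + k1) ∧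
      (blockPrefixes m a b k1 k2 k3).filter (fun i : Fin m => a ≤ (i : ℕ) ∧ (i : ℕ) < b) =
        univ.filter (fun i : Fin m => a ≤ (i : ℕ) ∧ (i : ℕ) < a + k2) ∧
      (blockPrefixes m a b k1 k2 k3).filter (fun i : Fin m => b ≤ (i : ℕ)) =
        univ.filter (fun i : Fin m => b ≤ (i : ℕ) ∧ (i : ℕ) < b + k3) := by
  refine ⟨?_, ?_, ?_⟩ <;>
  · ext i
    simp only [blockPrefixes, mem_filter, mem_univ, true_and]
    omega

theorem card_blockPrefixes {m a b k1 k2 k3 : ℕ} (h1 : k1 ≤ a) (h2 : a + k2 ≤ b)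
    (h3 : b + k3 ≤ m) :
    ((blockPrefixes m a b k1 k2 k3).filter fun i : Fin m => (i : ℕ) < a).card = k1 ∧
      ((blockPrefixes m a b k1 k2 k3).filter fun i : Fin m => a ≤ (i : ℕ) ∧ (i : ℕ) < b).card = k2 ∧
      ((blockPrefixes m a b k1 k2 k3).filter fun i : Fin m => b ≤ (i : ℕ)).card = k3 := by
  obtain ⟨e1, e2, e3⟩ := filter_blockPrefixes (m := m) (k3 := k3) h1 h2
  rw [e1, e2, e3]
  exact ⟨card_filter_Ico (by omega), card_filter_Ico (by omega), card_filter_Ico h3⟩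

theorem sum_blockPrefixes {m a b k1 k2 k3 : ℕ} (R : Fin m → ℕ) (h1 : k1 ≤ a)
    (h2 : a + k2 ≤ b) :
    prefixSum R a + prefixSum R b + ∑ i ∈ blockPrefixes m a b k1 k2 k3, R i =
      prefixSum R k1 + prefixSum R (a + k2) + prefixSum R (b + k3) := by
  obtain ⟨e1, e2, e3⟩ := filter_blockPrefixes (m := m) (k3 := k3) h1 h2
  rw [sum_eq_sum_three_blocks R (show a ≤ b by omega), e1, e2, e3]
  have s1 := prefixSum_add_sum_Ico R 0 k1
  have s2 := prefixSum_add_sum_Ico R a k2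
  have s3 := prefixSum_add_sum_Ico R b k3
  have s0 : prefixSum R 0 = 0 := by simp [prefixSum]
  rw [zero_add] at s1 ⊢
  omega

theorem sum_le_prefixSum_blocks {m a b : ℕ} {R : Fin m → ℕ} (hR : Antitone R) (hab : a ≤ b)
    (hb : b ≤ m) (X : Finset (Fin m)) :
    (X.filter fun i : Fin m => (i : ℕ) < a).card ≤ a ∧
      a + (X.filter fun i : Fin m => a ≤ (i : ℕ) ∧ (i : ℕ) < b).card ≤ b ∧
      b + (X.filter fun i : Fin m => b ≤ (i : ℕ)).card ≤ m ∧
      prefixSum R a + prefixSum R b + ∑ i ∈ X, R i ≤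
        prefixSum R (X.filter fun i : Fin m => (i : ℕ) < a).card +
          prefixSum R (a + (X.filter fun i : Fin m => a ≤ (i : ℕ) ∧ (i : ℕ) < b).card) +
          prefixSum R (b + (X.filter fun i : Fin m => b ≤ (i : ℕ)).card) := by
  have c1 := add_card_le_of_forall_mem_Ico (Nat.zero_le a) (hab.trans hb)
    (X := X.filter fun i : Fin m => (i : ℕ) < a) fun i hi => ⟨Nat.zero_le _, (mem_filter.1 hi).2⟩
  have c2 := add_card_le_of_forall_mem_Ico hab hb
    (X := X.filter fun i : Fin m => a ≤ (i : ℕ) ∧ (i : ℕ) < b) fun i hi => (mem_filter.1 hi).2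
  have c3 := add_card_le_of_forall_mem_Ico hb le_rfl
    (X := X.filter fun i : Fin m => b ≤ (i : ℕ)) fun i hi => ⟨(mem_filter.1 hi).2, i.isLt⟩
  have s1 := prefixSum_add_sum_le hR (a := 0) (X.filter fun i : Fin m => (i : ℕ) < a)
    fun i _ => Nat.zero_le _
  have s2 := prefixSum_add_sum_le hR
    (X.filter fun i : Fin m => a ≤ (i : ℕ) ∧ (i : ℕ) < b) fun i hi => (mem_filter.1 hi).2.1
  have s3 := prefixSum_add_sum_le hR (X.filter fun i : Fin m => b ≤ (i : ℕ))
    fun i hi => (mem_filter.1 hi).2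
  rw [zero_add] at c1 s1
  refine ⟨c1, c2, c3, ?_⟩
  rw [sum_eq_sum_three_blocks R hab X]
  omega

/-- There is a matrix in `𝒜(R,S)` with a zero block in rows `e'+1,…,m` and
columns `f'+1,…,n`, and a zero block in rows `e+1,…,m` and columns `f+1,…,n`
(equivalently, of the block form (1) of the paper), iff
`ψ_{e',e;f,f'} ≥ t_{e,f} + t_{e',f'}`. -/
theorem exists_matrix_zero_blocks_iff {m n : ℕ} (R : Fin m → ℕ)
    (S : Fin n → ℕ) (hRS : IsPartitionPair R S) (hne : (ARS R S).Nonempty)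
    (e e' f f' : ℕ) (h1 : e' < e) (h2 : e ≤ m) (h3 : f < f') (h4 : f' ≤ n) :
    (∃ A ∈ ARS R S, ∀ (i : Fin m) (j : Fin n),
        ((e' ≤ (i : ℕ) ∧ f' ≤ (j : ℕ)) ∨ (e ≤ (i : ℕ) ∧ f ≤ (j : ℕ))) →
          A i j = 0) ↔
      structMat R S e f + structMat R S e' f' ≤ psi R S e' e f f' := by
  have hsum := hRS.2.2.2.2
  rw [le_psi_iff R S h1.le h2 h3.le h4]
  simp only [structMat_add_le_psiTerm_iff]
  constructor
  · rintro ⟨A, hA, hzero⟩ i1 i2 i3 j1 j2 j3 p1 p2 p3 q1 q2 q3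
    have h := sum_le_card_inter_add_sum_compl (C := staircase m n e e' f f') hA.1 hA.2.1 hA.2.2
      (fun i j hij => hzero i j (by simpa [staircase, -not_or] using hij))
      (blockPrefixes m e' e i1 i2 i3) (blockPrefixes n f f' j1 j2 j3)
    rw [card_staircase_inter h1.le h3.le] at h
    obtain ⟨c1, c2, c3⟩ := card_blockPrefixes p1 p2 p3
    obtain ⟨d1, d2, d3⟩ := card_blockPrefixes q1 q2 q3
    rw [c1, c2, c3, d1, d2, d3] at h
    have hR := sum_blockPrefixes (k3 := i3) R p1 p2
    have hS := sum_blockPrefixes (k3 := j3) S q1 q2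
    have hS' := sum_add_sum_compl (blockPrefixes n f f' j1 j2 j3) S
    omega
  · intro h
    obtain ⟨A, hA, hzero⟩ := exists_mem_ARS_of_cut R S hsum (staircase m n e e' f f') (by
      intro X Y
      obtain ⟨p1, p2, p3, hR⟩ := sum_le_prefixSum_blocks hRS.1 h1.le h2 X
      obtain ⟨q1, q2, q3, hS⟩ := sum_le_prefixSum_blocks hRS.2.2.1 h3.le h4 Y
      have hcut := h _ _ _ _ _ _ p1 p2 p3 q1 q2 q3
      rw [card_staircase_inter h1.le h3.le]
      have hS' := sum_add_sum_compl Y S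
      omega)
    exact ⟨A, hA, fun i j hij => hzero i j (by simpa [staircase, -not_or] using hij)⟩
end
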